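/- Let E be a real Hilbert space, γ > 0, and f : E → ℝ a differentiable function whose gradient is γ-Lipschitz: ‖gradient f x − gradient f y‖ ≤ γ * ‖x − y‖ for all x, y. Let η > 0 with C := 1 − γ*η > 0, σ ∈ ℝ, fstar ∈ ℝ with f x ≥ fstar for all x. Let θ, h, Δ : ℕ → E satisfy, for every t: θ (t+1) = θ t − η • Δ t, ⟪h t, Δ t⟫ ≥ ‖h t‖², and ‖Δ t‖² ≤ ‖h t‖² + σ². Then for every T ≥ 1 there exists t < T such that ‖gradient f (θ t)‖² ≤ (2/(η*C*T)) * (f (θ 0) − fstar) + (2*γ*η/C) * σ² + (1/T) * ∑_{t<T} (1/(γ*η*C) + 2) * ‖gradient f (θ t) − h t‖². -/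

import Mathlib

open scoped RealInnerProductSpace

/-- Descent lemma: a function with `γ`-Lipschitz gradient lies below its quadratic upper model. -/
theorem le_add_inner_gradient_add_sq_of_lipschitz_gradient
    {E : Type*} [NormedAddCommGroup E] [InnerProductSpace ℝ E] [CompleteSpace E]
    {γ : ℝ} {f : E → ℝ} (hdiff : Differentiable ℝ f)
    (hlip : ∀ x y, ‖gradient f x - gradient f y‖ ≤ γ * ‖x - y‖) (x v : E) :
    f (x + v) ≤ f x + ⟪gradient f x, v⟫ + γ / 2 * ‖v‖ ^ 2 := by
  set ψ : ℝ → ℝ := fun s ↦ f (x + s • v) - s * ⟪gradient f x, v⟫ - γ / 2 * ‖v‖ ^ 2 * s ^ 2 with hψ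
  have hderiv (s : ℝ) : HasDerivAt ψ
      (⟪gradient f (x + s • v), v⟫ - ⟪gradient f x, v⟫ - γ * ‖v‖ ^ 2 * s) s := by
    have hline : HasDerivAt (fun s : ℝ ↦ x + s • v) v s := by
      simpa using ((hasDerivAt_id s).smul_const v).const_add x
    have hf := (hdiff (x + s • v)).hasFDerivAt.comp_hasDerivAt s hline
    rw [← inner_gradient_left] at hf
    refine ((hf.sub ((hasDerivAt_id s).mul_const ⟪gradient f x, v⟫)).sub
      ((hasDerivAt_pow 2 s).const_mul (γ / 2 * ‖v‖ ^ 2))).congr_deriv ?_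
    push_cast
    ring
  have hanti : AntitoneOn ψ (Set.Ici 0) := by
    refine antitoneOn_of_deriv_nonpos (convex_Ici 0)
      (fun s _ ↦ (hderiv s).continuousAt.continuousWithinAt)
      (fun s _ ↦ (hderiv s).differentiableAt.differentiableWithinAt) fun s hs ↦ ?_
    rw [interior_Ici, Set.mem_Ioi] at hs
    rw [(hderiv s).deriv, ← inner_sub_left]
    have hg : ‖gradient f (x + s • v) - gradient f x‖ ≤ γ * (s * ‖v‖) := by
      simpa [norm_smul, abs_of_pos hs] using hlip (x + s • v) x
    have hcs := (real_inner_le_norm (gradient f (x + s • v) - gradient f x) v).trans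
      (mul_le_mul_of_nonneg_right hg (norm_nonneg v))
    linarith
  have h01 := hanti (Set.mem_Ici.2 le_rfl) (Set.mem_Ici.2 zero_le_one) zero_le_one
  simp only [hψ, one_smul, zero_smul, add_zero] at h01
  linarith

/-- One step of inexact gradient descent bounds the squared gradient norm by the decrease of the
objective, the noise level and the squared deviation of the update direction. -/
theorem norm_gradient_sq_le_of_inexact_step
    {E : Type*} [NormedAddCommGroup E] [InnerProductSpace ℝ E] [CompleteSpace E]
    {γ : ℝ} (hγ : 0 < γ) {f : E → ℝ} (hdiff : Differentiable ℝ f)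
    (hlip : ∀ x y, ‖gradient f x - gradient f y‖ ≤ γ * ‖x - y‖)
    {η : ℝ} (hη : 0 < η) (hγη : 0 < 1 - γ * η) {σ : ℝ} {x h d : E}
    (hinner : ‖h‖ ^ 2 ≤ ⟪h, d⟫) (hnorm : ‖d‖ ^ 2 ≤ ‖h‖ ^ 2 + σ ^ 2) :
    ‖gradient f x‖ ^ 2 ≤ 2 / (η * (1 - γ * η)) * (f x - f (x - η • d))
      + 2 * γ * η / (1 - γ * η) * σ ^ 2
      + (1 / (γ * η * (1 - γ * η)) + 2) * ‖gradient f x - h‖ ^ 2 := by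
  set g := gradient f x
  have hdescent : f (x - η • d) ≤ f x - η * ⟪g, d⟫ + γ / 2 * η ^ 2 * ‖d‖ ^ 2 := by
    have := le_add_inner_gradient_add_sq_of_lipschitz_gradient hdiff hlip x (-(η • d))
    rw [← sub_eq_add_neg, inner_neg_right, inner_smul_right, norm_neg, norm_smul, mul_pow,
      Real.norm_eq_abs, sq_abs] at this
    linarith
  have hsplit : ⟪g, d⟫ = ⟪h, d⟫ + ⟪g - h, d⟫ := by
    rw [inner_sub_left]
    ring
  have hyoung : -(2 * γ * η * ⟪g - h, d⟫) ≤ ‖g - h‖ ^ 2 + γ ^ 2 * η ^ 2 * ‖d‖ ^ 2 := by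
    have := norm_add_sq_real (g - h) ((γ * η) • d)
    rw [inner_smul_right, norm_smul, mul_pow, Real.norm_eq_abs, sq_abs] at this
    nlinarith [sq_nonneg ‖g - h + (γ * η) • d‖]
  have htri : ‖g‖ ^ 2 ≤ 2 * ‖h‖ ^ 2 + 2 * ‖g - h‖ ^ 2 := by
    have := norm_sub_sq_real (g - h) h
    have hadd := norm_add_sq_real (g - h) h
    rw [sub_add_cancel] at hadd
    nlinarith [sq_nonneg ‖g - h - h‖]
  have hscaled : γ * η * (1 - γ * η) * ‖g‖ ^ 2 ≤ 2 * γ * (f x - f (x - η • d))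
      + 2 * γ ^ 2 * η ^ 2 * σ ^ 2 + (1 + 2 * (γ * η * (1 - γ * η))) * ‖g - h‖ ^ 2 := by
    have h₁ := mul_le_mul_of_nonneg_left hdescent hγ.le
    have h₂ := mul_le_mul_of_nonneg_left hinner (mul_pos hγ hη).le
    have h₃ := mul_le_mul_of_nonneg_left hnorm (sq_nonneg (γ * η))
    have h₄ := mul_le_mul_of_nonneg_left htri (mul_pos (mul_pos hγ hη) hγη).le
    rw [hsplit] at h₁
    linarith
  have hpos : 0 < γ * η * (1 - γ * η) := mul_pos (mul_pos hγ hη) hγη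
  refine le_of_mul_le_mul_left (hscaled.trans_eq ?_) hpos
  have hne := hγη.ne'
  generalize 1 - γ * η = c at hne ⊢
  field_simp

/-- Theorem 1 of the paper in deterministic surrogate form: convergence bound for
FL with selective layer fine-tuning (single local step). -/
theorem selective_finetuning_convergence
    {E : Type*} [NormedAddCommGroup E] [InnerProductSpace ℝ E] [CompleteSpace E]
    (γ : ℝ) (hγ : 0 < γ) (f : E → ℝ) (hdiff : Differentiable ℝ f)
    (hlip : ∀ x y, ‖gradient f x - gradient f y‖ ≤ γ * ‖x - y‖)
    (η : ℝ) (hη : 0 < η) (C : ℝ) (hC : C = 1 - γ * η) (hCpos : 0 < C)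
    (σ : ℝ) (fstar : ℝ) (hfstar : ∀ x, f x ≥ fstar)
    (θ h Δ : ℕ → E)
    (hstep : ∀ t, θ (t + 1) = θ t - η • Δ t)
    (hunbiased : ∀ t, ⟪h t, Δ t⟫ ≥ ‖h t‖ ^ 2)
    (hvar : ∀ t, ‖Δ t‖ ^ 2 ≤ ‖h t‖ ^ 2 + σ ^ 2) :
    ∀ T : ℕ, 1 ≤ T → ∃ t < T,
      ‖gradient f (θ t)‖ ^ 2
        ≤ (2 / (η * C * T)) * (f (θ 0) - fstar) + (2 * γ * η / C) * σ ^ 2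
          + (1 / T) * ∑ t ∈ Finset.range T,
              (1 / (γ * η * C) + 2) * ‖gradient f (θ t) - h t‖ ^ 2 := by
  intro T hT
  subst hC
  have hTpos : (0 : ℝ) < T := by exact_mod_cast hT
  have hsum : ∑ t ∈ Finset.range T, ‖gradient f (θ t)‖ ^ 2 ≤ ∑ _t ∈ Finset.range T,
      ((2 / (η * (1 - γ * η) * T)) * (f (θ 0) - fstar) + (2 * γ * η / (1 - γ * η)) * σ ^ 2
        + (1 / T) * ∑ t ∈ Finset.range T,
          (1 / (γ * η * (1 - γ * η)) + 2) * ‖gradient f (θ t) - h t‖ ^ 2) := by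
    have hstep_bound (t : ℕ) :=
      norm_gradient_sq_le_of_inexact_step hγ hdiff hlip hη hCpos (x := θ t) (hunbiased t) (hvar t)
    simp only [← hstep] at hstep_bound
    refine (Finset.sum_le_sum fun t _ ↦ hstep_bound t).trans ?_
    have hcoef : 0 ≤ 2 / (η * (1 - γ * η)) := by positivity
    have htel := mul_le_mul_of_nonneg_left (sub_le_sub_left (hfstar (θ T)) (f (θ 0))) hcoef
    rw [Finset.sum_add_distrib, Finset.sum_add_distrib, ← Finset.mul_sum,
      Finset.sum_range_sub' (fun t ↦ f (θ t)), Finset.sum_const, Finset.sum_const,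
      Finset.card_range, nsmul_eq_mul, nsmul_eq_mul, mul_add, mul_add, ← mul_assoc (T : ℝ) (1 / T),
      mul_one_div_cancel hTpos.ne', one_mul, ← mul_assoc (T : ℝ) (2 / _),
      div_mul_eq_div_div 2 _ (T : ℝ), mul_div_cancel₀ _ hTpos.ne']
    gcongr
  obtain ⟨t, ht, hle⟩ := Finset.exists_le_of_sum_le (Finset.nonempty_range_iff.2 (by omega)) hsum
  exact ⟨t, Finset.mem_range.1 ht, hle⟩
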